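/- arXiv:1510.01525 — 4 statements merged into one kernel-verified Lean document; each statement's English description precedes it below -/
import Mathlib

section
/- Let R₀ > 1 and ε > 0 be constants. Suppose f : [R₀, ∞) → ℝ is a positive, strictly increasing, twice differentiable function satisfying the differential inequality f''(r) ≥ ((1 + ε)/(r² log r))·f(r) for all r ≥ R₀ (i.e., f''(r) = a(r)² f(r) for some function a with a(r)² ≥ (1+ε)/(r² log r)). Then for every ε̃ with 0 < ε̃ < ε there exists R₁ > R₀ such that f(r) ≥ r·(log r)^{1+ε̃} for all r ≥ R₁. -/
open Filter Topology

/-- A function that starts out positive with nonnegative slope and satisfies `q h ≤ h''` with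
`q ≥ 0` stays positive. -/
lemma pos_of_mul_le_second_deriv {R : ℝ} {h h' h'' q : ℝ → ℝ}
    (hd : ∀ r, R ≤ r → HasDerivAt h (h' r) r) (hd' : ∀ r, R ≤ r → HasDerivAt h' (h'' r) r)
    (hq : ∀ r, R ≤ r → 0 ≤ q r) (hle : ∀ r, R ≤ r → q r * h r ≤ h'' r)
    (h0 : 0 < h R) (h1 : 0 ≤ h' R) : ∀ r, R ≤ r → 0 < h r := by
  have hc : ContinuousOn h (Set.Ici R) := fun x hx => (hd x hx).continuousAt.continuousWithinAt
  have hc' : ContinuousOn h' (Set.Ici R) := fun x hx => (hd' x hx).continuousAt.continuousWithinAt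
  intro r hr
  by_contra! hneg
  let S := {x ∈ Set.Ici R | h x ∈ Set.Iic 0}
  have hS : IsClosed S := hc.preimage_isClosed_of_isClosed isClosed_Ici isClosed_Iic
  have hbdd : BddBelow S := ⟨R, fun x hx => hx.1⟩
  obtain ⟨hRx, hx⟩ : sInf S ∈ S := hS.csInf_mem ⟨r, hr, hneg⟩ hbdd
  set x := sInf S
  have hRx : R ≤ x := hRx
  have hx : h x ≤ 0 := hx
  have hbefore : ∀ y, R ≤ y → y < x → 0 < h y := fun y hy hyx => by
    by_contra! hn
    exact absurd (csInf_le hbdd (show y ∈ S from ⟨hy, hn⟩)) (not_le.2 hyx)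
  have hsub : Set.Icc R x ⊆ Set.Ici R := fun y hy => hy.1
  have hmono' : MonotoneOn h' (Set.Icc R x) := by
    refine monotoneOn_of_hasDerivWithinAt_nonneg (f' := h'') (convex_Icc R x) (hc'.mono hsub) ?_ ?_
    · intro y hy
      rw [interior_Icc] at hy
      exact (hd' y hy.1.le).hasDerivWithinAt
    · intro y hy
      rw [interior_Icc] at hy
      exact (mul_nonneg (hq y hy.1.le) (hbefore y hy.1.le hy.2).le).trans (hle y hy.1.le)
  have hmono : MonotoneOn h (Set.Icc R x) := by
    refine monotoneOn_of_hasDerivWithinAt_nonneg (f' := h') (convex_Icc R x) (hc.mono hsub) ?_ ?_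
    · intro y hy
      rw [interior_Icc] at hy
      exact (hd y hy.1.le).hasDerivWithinAt
    · intro y hy
      rw [interior_Icc] at hy
      exact h1.trans (hmono' ⟨le_rfl, hRx⟩ ⟨hy.1.le, hy.2.le⟩ hy.1.le)
  linarith [hmono ⟨le_rfl, hRx⟩ ⟨hRx, le_rfl⟩ hRx]

lemma hasDerivAt_mul_log_rpow (δ : ℝ) {x : ℝ} (hx : 1 < x) :
    HasDerivAt (fun r => r * Real.log r ^ (1 + δ))
      (Real.log x ^ (1 + δ) + (1 + δ) * Real.log x ^ δ) x := by
  have hx0 : x ≠ 0 := by positivity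
  have h := (hasDerivAt_id x).mul
    ((Real.hasDerivAt_log hx0).rpow_const (p := 1 + δ) (Or.inl (Real.log_pos hx).ne'))
  refine h.congr_deriv ?_
  simp only [id, add_sub_cancel_left]
  field_simp

lemma hasDerivAt_log_rpow_add (δ : ℝ) {x : ℝ} (hx : 1 < x) :
    HasDerivAt (fun r => Real.log r ^ (1 + δ) + (1 + δ) * Real.log r ^ δ)
      ((1 + δ) * (Real.log x + δ) * Real.log x ^ (δ - 1) / x) x := by
  have hx0 : x ≠ 0 := by positivity
  have hL := Real.log_pos hx
  have h := ((Real.hasDerivAt_log hx0).rpow_const (p := 1 + δ) (Or.inl hL.ne')).add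
    (((Real.hasDerivAt_log hx0).rpow_const (p := δ) (Or.inl hL.ne')).const_mul (1 + δ))
  refine h.congr_deriv ?_
  have hδ : Real.log x ^ δ = Real.log x ^ (δ - 1) * Real.log x := by
    rw [← Real.rpow_add_one hL.ne', sub_add_cancel]
  simp only [add_sub_cancel_left, hδ]
  field_simp

/-- For `log x` large, `r (log r) ^ (1 + δ)` is a subsolution of `g'' = (1 + ε) / (r² log r) g`. -/
lemma second_deriv_mul_log_rpow_le {δ ε x : ℝ} (hx : 1 < x)
    (hlog : (1 + δ) * δ ≤ (ε - δ) * Real.log x) :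
    (1 + δ) * (Real.log x + δ) * Real.log x ^ (δ - 1) / x ≤
      (1 + ε) / (x ^ 2 * Real.log x) * (x * Real.log x ^ (1 + δ)) := by
  have hL := Real.log_pos hx
  have hx0 : 0 < x := by positivity
  have hδ : Real.log x ^ (1 + δ) = Real.log x ^ (δ - 1) * Real.log x ^ 2 := by
    rw [← Real.rpow_natCast, ← Real.rpow_add hL]
    congr 1
    push_cast
    ring
  have hrhs : (1 + ε) / (x ^ 2 * Real.log x) * (x * Real.log x ^ (1 + δ)) =
      (1 + ε) * Real.log x * Real.log x ^ (δ - 1) / x := by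
    rw [hδ]
    field_simp
  rw [hrhs]
  gcongr ?_ * _ / _
  linarith

/-- Choi, Prop. 3.4, first estimate.
If `f : [R₀,∞) → ℝ` is positive, strictly increasing, twice differentiable and satisfies
`f''(r) ≥ ((1+ε)/(r² log r)) f(r)` for `r ≥ R₀`, then for every `0 < ε̃ < ε` there is
`R₁ > R₀` with `f(r) ≥ r (log r)^(1+ε̃)` for all `r ≥ R₁`. -/
theorem choi_lower_bound (R₀ ε : ℝ) (hR₀ : 1 < R₀) (hε : 0 < ε)
    (f f' f'' : ℝ → ℝ)
    (hpos : ∀ r, R₀ ≤ r → 0 < f r)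
    (hmono : StrictMonoOn f (Set.Ici R₀))
    (hderiv1 : ∀ r, R₀ ≤ r → HasDerivAt f (f' r) r)
    (hderiv2 : ∀ r, R₀ ≤ r → HasDerivAt f' (f'' r) r)
    (hineq : ∀ r, R₀ ≤ r → ((1 + ε) / (r ^ 2 * Real.log r)) * f r ≤ f'' r) :
    ∀ ε' : ℝ, 0 < ε' → ε' < ε →
      ∃ R₁ : ℝ, R₀ < R₁ ∧ ∀ r, R₁ ≤ r → r * Real.log r ^ (1 + ε') ≤ f r := by
  intro ε' hε' hlt
  obtain ⟨δ, hδ', hδε⟩ := exists_between hlt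
  have hδ : 0 < δ := hε'.trans hδ'
  have hq : ∀ r, R₀ ≤ r → 0 < (1 + ε) / (r ^ 2 * Real.log r) := fun r hr => by
    have := Real.log_pos (hR₀.trans_le hr)
    have : 0 < r := by linarith
    positivity
  have hmono' : MonotoneOn f' (Set.Ici R₀) := by
    refine monotoneOn_of_hasDerivWithinAt_nonneg (f' := f'') (convex_Ici R₀)
      (fun x hx => (hderiv2 x hx).continuousAt.continuousWithinAt) ?_ ?_
    · intro x hx
      exact (hderiv2 x (interior_subset hx)).hasDerivWithinAt
    · intro x hx
      have hx := interior_subset hx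
      exact (mul_pos (hq x hx) (hpos x hx)).le.trans (hineq x hx)
  obtain ⟨a, ha, hfa⟩ := exists_hasDerivAt_eq_slope f f' (lt_add_one R₀)
    (fun x hx => (hderiv1 x hx.1).continuousAt.continuousWithinAt)
    (fun x hx => hderiv1 x hx.1.le)
  have hfa_pos : 0 < f' a := by
    rw [hfa, add_sub_cancel_left, div_one, sub_pos]
    exact hmono Set.self_mem_Ici (by simp) (lt_add_one R₀)
  obtain ⟨R, hR⟩ := eventually_atTop.1
    ((Real.tendsto_log_atTop.eventually_ge_atTop ((1 + δ) * δ / (ε - δ))).and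
      (eventually_ge_atTop a))
  have haR : a ≤ R := (hR R le_rfl).2
  have hR₀R : R₀ < R := ha.1.trans_le haR
  have hlog : ∀ r, R ≤ r → (1 + δ) * δ ≤ (ε - δ) * Real.log r := fun r hr => by
    have := (hR r hr).1
    rwa [div_le_iff₀' (by linarith)] at this
  have hfR : 0 < f R := hpos R hR₀R.le
  have hfR' : 0 < f' R := hfa_pos.trans_le (hmono' ha.1.le hR₀R.le haR)
  have hLR : 0 < Real.log R := Real.log_pos (by linarith)
  set g : ℝ → ℝ := fun r => r * Real.log r ^ (1 + δ) with hg
  set g' : ℝ → ℝ := fun r => Real.log r ^ (1 + δ) + (1 + δ) * Real.log r ^ δ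
  have hgR : 0 < g R := mul_pos (by linarith) (Real.rpow_pos_of_pos hLR _)
  have hgR' : 0 < g' R := by positivity
  obtain ⟨c, hc, hcmin⟩ := exists_between (lt_min (div_pos hfR hgR) (div_pos hfR' hgR'))
  have hc0 : c * g R < f R := (lt_div_iff₀ hgR).1 (hcmin.trans_le (min_le_left _ _))
  have hc1 : c * g' R < f' R := (lt_div_iff₀ hgR').1 (hcmin.trans_le (min_le_right _ _))
  have hcomp : ∀ r, R ≤ r → 0 < f r - c * g r := by
    refine pos_of_mul_le_second_deriv (h' := fun r => f' r - c * g' r)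
      (h'' := fun r => f'' r - c * ((1 + δ) * (Real.log r + δ) * Real.log r ^ (δ - 1) / r))
      (q := fun r => (1 + ε) / (r ^ 2 * Real.log r)) ?_ ?_ ?_ ?_ (sub_pos.2 hc0)
      (sub_pos.2 hc1).le
    · exact fun r hr => (hderiv1 r (by linarith)).sub
        ((hasDerivAt_mul_log_rpow δ (by linarith)).const_mul c)
    · exact fun r hr => (hderiv2 r (by linarith)).sub
        ((hasDerivAt_log_rpow_add δ (by linarith)).const_mul c)
    · exact fun r hr => (hq r (by linarith)).le
    · intro r hr
      have h1 := hineq r (by linarith)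
      have h2 := mul_le_mul_of_nonneg_left
        (second_deriv_mul_log_rpow_le (by linarith) (hlog r hr)) hc.le
      simp only [hg]
      linarith
  obtain ⟨R₁, hR₁⟩ := eventually_atTop.1
    ((((tendsto_rpow_atTop (sub_pos.2 hδ')).comp
      Real.tendsto_log_atTop).eventually_ge_atTop c⁻¹).and (eventually_ge_atTop R))
  refine ⟨R₁, hR₀R.trans_le (hR₁ R₁ le_rfl).2, fun r hr => ?_⟩
  obtain ⟨hcr, hRr⟩ := hR₁ r hr
  have hr0 : 0 < r := by linarith
  have hL : 0 < Real.log r := Real.log_pos (by linarith)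
  have hcr : 1 ≤ c * Real.log r ^ (δ - ε') := (inv_le_iff_one_le_mul₀' hc).1 hcr
  calc r * Real.log r ^ (1 + ε')
      ≤ (c * Real.log r ^ (δ - ε')) * (r * Real.log r ^ (1 + ε')) :=
        le_mul_of_one_le_left (by positivity) hcr
    _ = c * (r * (Real.log r ^ (δ - ε') * Real.log r ^ (1 + ε'))) := by ring
    _ = c * g r := by
        rw [← Real.rpow_add hL]
        simp only [hg]
        ring_nf
    _ ≤ f r := (sub_pos.1 (hcomp r hRr)).le
end

section
/- Let R₀ > 1 and ε > 0 be constants. Suppose f : [R₀, ∞) → ℝ is a positive, strictly increasing, twice differentiable function satisfying the differential inequality f''(r) ≥ ((1 + ε)/(r² log r))·f(r) for all r ≥ R₀ (i.e., f''(r) = a(r)² f(r) for some function a with a(r)² ≥ (1+ε)/(r² log r)). Then for every ε̃ with 0 < ε̃ < ε there exists R₁ > R₀ such that f'(r)/f(r) ≥ 1/r + (1 + ε̃)/(r log r) for all r ≥ R₁. -/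
/-- A function whose derivative is at least `δ / (r log r)` wherever it is nonpositive
is eventually nonnegative, since `∫ dr / (r log r)` diverges. -/
theorem eventually_nonneg_of_div_mul_log_le_deriv {A δ : ℝ} (hA : 1 < A) (hδ : 0 < δ)
    {G G' : ℝ → ℝ} (hG : ∀ r, A ≤ r → HasDerivAt G (G' r) r)
    (hle : ∀ r, A ≤ r → G r ≤ 0 → δ / (r * Real.log r) ≤ G' r) :
    ∃ R, A ≤ R ∧ ∀ r, R ≤ r → 0 ≤ G r := by
  obtain ⟨R, hAR, hR⟩ : ∃ R, A ≤ R ∧ 0 ≤ G R := by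
    by_contra! hneg
    have hH : ∀ r, A ≤ r → HasDerivAt (fun x ↦ G x - δ * Real.log (Real.log x))
        (G' r - δ * (r⁻¹ / Real.log r)) r := by
      intro r hr
      have h1 : 1 < r := by linarith
      exact (hG r hr).sub
        (((Real.hasDerivAt_log (by positivity)).log (Real.log_pos h1).ne').const_mul δ)
    have hmono : MonotoneOn (fun x ↦ G x - δ * Real.log (Real.log x)) (Set.Ici A) := by
      refine monotoneOn_of_hasDerivWithinAt_nonneg (convex_Ici A)
        (fun x hx ↦ (hH x hx).continuousAt.continuousWithinAt)
        (fun x hx ↦ (hH x (interior_subset hx)).hasDerivWithinAt) ?_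
      intro x hx
      have hx' : A ≤ x := interior_subset hx
      have h := hle x hx' (hneg x hx').le
      have e : δ * (x⁻¹ / Real.log x) = δ / (x * Real.log x) := by
        rw [div_eq_mul_inv, div_eq_mul_inv, mul_inv]
      rw [e]
      linarith
    have htend : Filter.Tendsto (fun x ↦ δ * Real.log (Real.log x)) Filter.atTop Filter.atTop :=
      (Real.tendsto_log_atTop.comp Real.tendsto_log_atTop).const_mul_atTop hδ
    obtain ⟨x, hx, hAx⟩ := ((htend.eventually_ge_atTop
      (δ * Real.log (Real.log A) - G A)).and (Filter.eventually_ge_atTop A)).exists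
    have h1 := hmono Set.self_mem_Ici hAx hAx
    have h2 := hneg x hAx
    dsimp only at h1
    linarith
  refine ⟨R, hAR, fun r hr ↦ ?_⟩
  have key := image_le_of_deriv_right_lt_deriv_boundary (f := fun x ↦ -G x)
    (f' := fun x ↦ -G' x) (a := R) (b := r) (B := fun _ ↦ 0) (B' := fun _ ↦ 0)
    (fun x hx ↦ (hG x (hAR.trans hx.1)).neg.continuousAt.continuousWithinAt)
    (fun x hx ↦ (hG x (hAR.trans hx.1)).neg.hasDerivWithinAt)
    (by simpa using hR) (fun x ↦ hasDerivAt_const x 0)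
    (fun x hx hx0 ↦ by
      have hAx := hAR.trans hx.1
      have h := hle x hAx (by linarith)
      have hx1 : 1 < x := by linarith
      have hlog := Real.log_pos hx1
      have : 0 < δ / (x * Real.log x) := by positivity
      linarith)
  have := key (Set.right_mem_Icc.2 hr)
  linarith

/-- The Riccati inequality behind `choi_logderiv_bound`: `w` stands for `r f'/f`
and `L` for `log r`. -/
theorem riccati_lower_bound {ε ε' w L : ℝ} (hε' : 0 < ε') (hlt : ε' < ε) (hL : 0 < L)
    (hL' : 2 * ε' * (1 + ε') / (ε - ε') ≤ L) (hw : 0 ≤ w) (hw' : w ≤ 1 + (1 + ε') / L) :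
    (ε - ε') / 2 / L ≤ w - w ^ 2 + (1 + ε) / L + (1 + ε') / L ^ 2 := by
  have hd : 0 < ε - ε' := by linarith
  set φ := (1 + ε') / L with hφ
  have hφ0 : 0 < φ := by positivity
  have h1 : -(φ + φ ^ 2) ≤ w - w ^ 2 := by
    nlinarith [mul_nonneg (sub_nonneg.2 hw') (add_nonneg hw hφ0.le)]
  rw [div_le_iff₀ hd] at hL'
  have h2 : (1 + ε) / L - φ - φ ^ 2 + (1 + ε') / L ^ 2 - (ε - ε') / 2 / L
      = (L * (ε - ε') - 2 * ε' * (1 + ε')) / (2 * L ^ 2) := by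
    rw [hφ]
    field_simp
    ring
  have h3 : 0 ≤ (L * (ε - ε') - 2 * ε' * (1 + ε')) / (2 * L ^ 2) :=
    div_nonneg (by linarith) (by positivity)
  linarith

/-- Choi, Prop. 3.4, second estimate.
If `f : [R₀,∞) → ℝ` is positive, strictly increasing, twice differentiable and satisfies
`f''(r) ≥ ((1+ε)/(r² log r)) f(r)` for `r ≥ R₀`, then for every `0 < ε̃ < ε` there is
`R₁ > R₀` with `f'(r)/f(r) ≥ 1/r + (1+ε̃)/(r log r)` for all `r ≥ R₁`. -/
theorem choi_logderiv_bound (R₀ ε : ℝ) (hR₀ : 1 < R₀) (hε : 0 < ε)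
    (f f' f'' : ℝ → ℝ)
    (hpos : ∀ r, R₀ ≤ r → 0 < f r)
    (hmono : StrictMonoOn f (Set.Ici R₀))
    (hderiv1 : ∀ r, R₀ ≤ r → HasDerivAt f (f' r) r)
    (hderiv2 : ∀ r, R₀ ≤ r → HasDerivAt f' (f'' r) r)
    (hineq : ∀ r, R₀ ≤ r → ((1 + ε) / (r ^ 2 * Real.log r)) * f r ≤ f'' r) :
    ∀ ε' : ℝ, 0 < ε' → ε' < ε →
      ∃ R₁ : ℝ, R₀ < R₁ ∧ ∀ r, R₁ ≤ r →
        1 / r + (1 + ε') / (r * Real.log r) ≤ f' r / f r := by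
  intro ε' hε' hlt
  have hf' : ∀ r, R₀ ≤ r → 0 ≤ f' r := by
    intro r hr
    have h := hmono.monotoneOn.derivWithin_nonneg (x := r)
    rwa [(hderiv1 r hr).hasDerivWithinAt.derivWithin (uniqueDiffOn_Ici R₀ r hr)] at h
  obtain ⟨A, hAL, hA⟩ := ((Real.tendsto_log_atTop.eventually_ge_atTop
    (2 * ε' * (1 + ε') / (ε - ε'))).and (Filter.eventually_gt_atTop R₀)).exists
  have hG : ∀ r, A ≤ r → HasDerivAt
      (fun x ↦ x * f' x / f x - 1 - (1 + ε') / Real.log x)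
      (((1 * f' r + r * f'' r) * f r - r * f' r * f' r) / f r ^ 2
        - (0 * Real.log r - (1 + ε') * r⁻¹) / Real.log r ^ 2) r := by
    intro r hr
    have hr0 : R₀ ≤ r := hA.le.trans hr
    have hr1 : 1 < r := by linarith
    exact (((((hasDerivAt_id r).mul (hderiv2 r hr0)).div (hderiv1 r hr0)
      (hpos r hr0).ne').sub_const 1).sub
      ((hasDerivAt_const r (1 + ε')).div (Real.hasDerivAt_log (by positivity))
        (Real.log_pos hr1).ne'))
  obtain ⟨R, hAR, hR⟩ := eventually_nonneg_of_div_mul_log_le_deriv (hR₀.trans hA)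
    (half_pos (sub_pos.2 hlt)) hG (by
      intro r hr hneg
      have hr0 : R₀ ≤ r := hA.le.trans hr
      have hr1 : 1 < r := by linarith
      have hrpos : 0 < r := by linarith
      have hL := Real.log_pos hr1
      have hf := hpos r hr0
      have hw : 0 ≤ r * f' r / f r := by have := hf' r hr0; positivity
      have key := riccati_lower_bound hε' hlt hL
        (hAL.trans (Real.log_le_log (by linarith) hr)) hw (by linarith)
      have hi : (1 + ε) / Real.log r ≤ r ^ 2 * f'' r / f r := by
        rw [le_div_iff₀ hf]
        calc (1 + ε) / Real.log r * f r
            = r ^ 2 * ((1 + ε) / (r ^ 2 * Real.log r) * f r) := by field_simp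
          _ ≤ r ^ 2 * f'' r := by gcongr; exact hineq r hr0
      have e1 : (ε - ε') / 2 / (r * Real.log r) = (ε - ε') / 2 / Real.log r / r := by
        field_simp
      have e2 : ((1 * f' r + r * f'' r) * f r - r * f' r * f' r) / f r ^ 2
          - (0 * Real.log r - (1 + ε') * r⁻¹) / Real.log r ^ 2
          = (r * f' r / f r - (r * f' r / f r) ^ 2 + r ^ 2 * f'' r / f r
            + (1 + ε') / Real.log r ^ 2) / r := by
        field_simp
        ring
      rw [e1, e2]
      gcongr
      linarith)
  refine ⟨R, hA.trans_le hAR, fun r hr ↦ ?_⟩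
  have hr0 : R₀ ≤ r := by linarith
  have hrpos : 0 < r := by linarith
  have hL := Real.log_pos (hR₀.trans_le hr0)
  have hf := hpos r hr0
  have h := hR r hr
  have e : f' r / f r - (1 / r + (1 + ε') / (r * Real.log r))
      = (r * f' r / f r - 1 - (1 + ε') / Real.log r) / r := by
    field_simp
    ring
  have := div_nonneg h hrpos.le
  linarith
end

section
/- Let ε₀ ∈ (0,1) and set λ = 1 + ε₀. Let c₁ > 0 and C > 0 be constants, let n ≥ 2 be an integer, let ε̃ > 0, and let 𝒞 : [0,∞) → [0,∞) be a bounded function. Then there exists a₀ > e such that for every a ≥ a₀ and every t ≥ a·(log a)^{1+ε̃} one has exp( −(c₁ t / a)·( log( e + c₁ t / a ) )^{−λ} ) · ( log(1+a) + 𝒞(a) ) · t^{C(n−1)} ≤ a^{−2}. -/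
open Filter Asymptotics in
/-- The power-log combination `A s^p + B log s` with `p < 1` is eventually dominated by
`s (log (e + s))^(-l)`. -/
theorem eventually_rpow_add_log_le_mul_log_rpow_neg (A B p l : ℝ) (hp : 0 < p) (hp1 : p < 1)
    (hl : 0 < l) :
    ∀ᶠ s : ℝ in atTop,
      A * s ^ p + B * Real.log s ≤ s * Real.log (Real.exp 1 + s) ^ (-l) := by
  obtain ⟨q, hpq, hq1⟩ := exists_between hp1
  have hpow : (fun s : ℝ => s ^ p) =o[atTop] fun s => s ^ q := by
    refine (isLittleO_iff_tendsto' ?_).2 ((tendsto_rpow_neg_atTop (sub_pos.2 hpq)).congr' ?_)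
    · filter_upwards [eventually_gt_atTop 0] with s hs h
      exact absurd h (Real.rpow_pos_of_pos hs q).ne'
    · filter_upwards [eventually_gt_atTop 0] with s hs
      rw [neg_sub, Real.rpow_sub hs]
  have hf : (fun s : ℝ => A * s ^ p + B * Real.log s) =o[atTop] fun s => s ^ q :=
    (hpow.const_mul_left A).add
      ((isLittleO_log_rpow_atTop (hp.trans hpq)).const_mul_left B)
  have hg : (fun s : ℝ => (2 * Real.log s) ^ l) =o[atTop] fun s => s ^ (1 - q) := by
    refine ((isLittleO_log_rpow_rpow_atTop l (sub_pos.2 hq1)).const_mul_left (2 ^ l)).congr'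
      ?_ EventuallyEq.rfl
    filter_upwards [eventually_ge_atTop 1] with s hs
    rw [Real.mul_rpow zero_le_two (Real.log_nonneg hs)]
  filter_upwards [(hf.mul hg).bound one_pos, eventually_ge_atTop (Real.exp 1),
    eventually_ge_atTop 2] with s hs hse hs2
  have hs0 : 0 < s := by linarith
  have hlog : 1 ≤ Real.log (Real.exp 1 + s) := by
    rw [Real.le_log_iff_exp_le (by positivity)]
    linarith
  have hlog2 : Real.log (Real.exp 1 + s) ≤ 2 * Real.log s := by
    rw [← Real.log_rpow hs0]
    apply Real.log_le_log (by positivity)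
    rw [Real.rpow_two]
    nlinarith
  have hpos : 0 < Real.log (Real.exp 1 + s) ^ l := Real.rpow_pos_of_pos (by linarith) l
  rw [Real.rpow_neg (by linarith), ← div_eq_mul_inv, le_div_iff₀ hpos]
  rw [← Real.rpow_add hs0, add_sub_cancel, Real.rpow_one, one_mul, norm_mul,
    Real.norm_of_nonneg hs0.le] at hs
  refine le_trans ?_ hs
  refine mul_le_mul (Real.le_norm_self _) ?_ hpos.le (norm_nonneg _)
  exact (Real.rpow_le_rpow (by linarith) hlog2 hl.le).trans (Real.le_norm_self _)


/-- With `λ = 1 + ε₀`, `ε₀ ∈ (0,1)`, for all sufficiently large `a` and all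
`t ≥ a (log a)^(1+ε̃)` one has
`exp(-(c₁t/a)(log(e + c₁t/a))^(-λ)) (log(1+a) + 𝒞(a)) t^(C(n-1)) ≤ a^(-2)`. -/
theorem exp_decay_dominates (ε₀ c₁ C ε' : ℝ) (n : ℕ)
    (hε₀ : 0 < ε₀) (hε₀1 : ε₀ < 1) (hc₁ : 0 < c₁) (hC : 0 < C) (hn : 2 ≤ n)
    (hε' : 0 < ε')
    (𝒞 : ℝ → ℝ) (h𝒞nonneg : ∀ x, 0 ≤ x → 0 ≤ 𝒞 x)
    (h𝒞bdd : ∃ M : ℝ, ∀ x, 0 ≤ x → 𝒞 x ≤ M) :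
    ∃ a₀ : ℝ, Real.exp 1 < a₀ ∧ ∀ a, a₀ ≤ a →
      ∀ t, a * Real.log a ^ (1 + ε') ≤ t →
        Real.exp (-(c₁ * t / a) * Real.log (Real.exp 1 + c₁ * t / a) ^ (-(1 + ε₀))) *
            (Real.log (1 + a) + 𝒞 a) * t ^ (C * ((n : ℝ) - 1)) ≤ a ^ (-2 : ℝ) := by
  obtain ⟨M, hM⟩ := h𝒞bdd
  have hn' : (2 : ℝ) ≤ n := by exact_mod_cast hn
  set K : ℝ := C * ((n : ℝ) - 1)
  have hK0 : 0 < K := mul_pos hC (by linarith)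
  set p : ℝ := (1 + ε')⁻¹ with hp
  have hp0 : 0 < p := by positivity
  have hp1 : p < 1 := inv_lt_one_of_one_lt₀ (by linarith)
  obtain ⟨s₀, hs₀⟩ := Filter.eventually_atTop.1
    (eventually_rpow_add_log_le_mul_log_rpow_neg ((K + 4) * (c₁⁻¹) ^ p) K p (1 + ε₀) hp0 hp1
      (by linarith))
  have hlim : Filter.Tendsto (fun a : ℝ => c₁ * Real.log a ^ (1 + ε')) Filter.atTop
      Filter.atTop :=
    ((tendsto_rpow_atTop (by linarith)).comp Real.tendsto_log_atTop).const_mul_atTop hc₁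
  obtain ⟨a₀, ha₀⟩ := Filter.eventually_atTop.1
    ((hlim.eventually_ge_atTop s₀).and
      ((Real.tendsto_log_atTop.eventually_ge_atTop (K * -Real.log c₁)).and
        ((Real.isLittleO_log_id_atTop.bound (by norm_num : (0 : ℝ) < 1 / 2)).and
          (Filter.eventually_ge_atTop (2 * (1 + M))))))
  refine ⟨max a₀ (Real.exp 1 + 1), lt_max_of_lt_right (by linarith), fun a ha t ht => ?_⟩
  obtain ⟨has, haL, halog, haM⟩ := ha₀ a (le_trans (le_max_left _ _) ha)
  have hae : Real.exp 1 + 1 ≤ a := le_trans (le_max_right _ _) ha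
  have ha1 : 1 < a := by linarith [Real.exp_pos 1]
  have ha0 : 0 < a := by linarith
  have hL : 0 < Real.log a := Real.log_pos ha1
  have hLpow : 0 < Real.log a ^ (1 + ε') := Real.rpow_pos_of_pos hL _
  have ht0 : 0 < t := lt_of_lt_of_le (by positivity) ht
  set s : ℝ := c₁ * t / a with hs
  have hs0 : 0 < s := by positivity
  have hLs : Real.log a ^ (1 + ε') ≤ c₁⁻¹ * s := by
    have : c₁⁻¹ * s = t / a := by rw [hs]; field_simp
    rw [this, le_div_iff₀ ha0]
    linarith
  have hs_ge : s₀ ≤ s := by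
    refine has.trans ?_
    rwa [← le_inv_mul_iff₀ hc₁]
  have hLp : Real.log a ≤ (c₁⁻¹) ^ p * s ^ p := by
    rw [← Real.mul_rpow (by positivity) hs0.le]
    have h := Real.rpow_le_rpow hLpow.le hLs hp0.le
    rwa [← Real.rpow_mul hL.le, hp, mul_inv_cancel₀ (by linarith), Real.rpow_one] at h
  have hmain := hs₀ s hs_ge
  have hlogt : Real.log t = Real.log s + Real.log a - Real.log c₁ := by
    rw [hs, Real.log_div (by positivity) ha0.ne', Real.log_mul hc₁.ne' ht0.ne']
    ring
  have hlog1a : Real.log (1 + a) ≤ 1 + Real.log a := by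
    have h : Real.log (1 + a) ≤ Real.log (Real.exp 1 * a) :=
      Real.log_le_log (by linarith) (by nlinarith [Real.add_one_le_exp (1 : ℝ)])
    rwa [Real.log_mul (Real.exp_pos 1).ne' ha0.ne', Real.log_exp] at h
  have hfactor : Real.log (1 + a) + 𝒞 a ≤ Real.exp (Real.log a) := by
    rw [Real.norm_of_nonneg hL.le, id, Real.norm_of_nonneg ha0.le] at halog
    rw [Real.exp_log ha0]
    linarith [hM a ha0.le]
  have hKL := mul_le_mul_of_nonneg_left hLp (by linarith : (0 : ℝ) ≤ K + 4)
  rw [Real.rpow_def_of_pos ht0, Real.rpow_def_of_pos ha0]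
  calc _ ≤ Real.exp (-s * Real.log (Real.exp 1 + s) ^ (-(1 + ε₀))) * Real.exp (Real.log a) *
        Real.exp (Real.log t * K) := by gcongr
    _ ≤ _ := by
      rw [← Real.exp_add, ← Real.exp_add, Real.exp_le_exp, hlogt]
      linarith
end

section
/- Let λ > 1, c₁ > 0, C > 0 be constants, let n ≥ 2 be an integer, let ε̃ > 0, and let 𝒞 : [0,∞) → [0,∞) be a bounded function. For a > e define f_a : (0,∞) → ℝ by f_a(t) = (c₁ t / a)·( log( e + c₁ t / a ) )^{−λ} − log( log(1+a) + 𝒞(a) ) − C(n−1)·log t − 2 log a. Then there exists a₀ > e such that for every a ≥ a₀ the derivative satisfies f_a'(t) ≥ 0 for all t ≥ a·(log a)^{1+ε̃}; in particular f_a is nondecreasing on the interval [a·(log a)^{1+ε̃}, ∞). -/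
/-- The auxiliary function `f_a(t)` from the proof of Lemma `fsmall`:
`f_a(t) = (c₁ t / a)(log(e + c₁ t / a))^(-λ) − log(log(1+a) + 𝒞(a)) − C(n−1) log t − 2 log a`. -/
noncomputable def fA (c₁ C lam : ℝ) (n : ℕ) (𝒞 : ℝ → ℝ) (a t : ℝ) : ℝ :=
  c₁ * t / a * Real.log (Real.exp 1 + c₁ * t / a) ^ (-lam)
    - Real.log (Real.log (1 + a) + 𝒞 a) - C * ((n : ℝ) - 1) * Real.log t
    - 2 * Real.log a

open Filter in
/-- A linear function eventually dominates any power of the logarithm, in the form in which it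
controls the derivative of `u ↦ u * log (e + u) ^ (-lam)`. -/
theorem eventually_log_exp_one_add_bounds (lam K : ℝ) (hK : 0 < K) :
    ∀ᶠ u : ℝ in atTop, 0 < u ∧ 2 * lam ≤ Real.log (Real.exp 1 + u) ∧
      2 * K * Real.log (Real.exp 1 + u) ^ lam ≤ u := by
  have hshift : Tendsto (fun u : ℝ => Real.exp 1 + u) atTop atTop :=
    tendsto_atTop_add_const_left _ _ tendsto_id
  have hlog : ∀ᶠ u : ℝ in atTop, 2 * lam ≤ Real.log (Real.exp 1 + u) :=
    (Real.tendsto_log_atTop.comp hshift).eventually_ge_atTop _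
  have hpow := hshift.eventually ((isLittleO_log_rpow_rpow_atTop lam one_pos).bound
    (show (0 : ℝ) < 1 / (4 * K) by positivity))
  filter_upwards [hlog, hpow, eventually_ge_atTop (Real.exp 1)] with u h1 h2 h3
  have he : 0 < Real.exp 1 := Real.exp_pos 1
  refine ⟨by linarith, h1, ?_⟩
  rw [Real.rpow_one, Real.norm_of_nonneg (by linarith : (0 : ℝ) ≤ Real.exp 1 + u)] at h2
  have h4 := (Real.le_norm_self _).trans h2
  calc 2 * K * Real.log (Real.exp 1 + u) ^ lam
      ≤ 2 * K * (1 / (4 * K) * (Real.exp 1 + u)) := by gcongr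
    _ = (Real.exp 1 + u) / 2 := by field_simp; norm_num
    _ ≤ u := by linarith

theorem one_lt_log_exp_one_add {u : ℝ} (hu : 0 < u) : 1 < Real.log (Real.exp 1 + u) := by
  rw [Real.lt_log_iff_exp_lt (by positivity)]
  linarith

theorem hasDerivAt_fA (c₁ C lam : ℝ) (n : ℕ) (𝒞 : ℝ → ℝ) {a t : ℝ} (ht : 0 < t)
    (hu : 0 < c₁ * t / a) :
    HasDerivAt (fA c₁ C lam n 𝒞 a)
      ((c₁ * t / a * Real.log (Real.exp 1 + c₁ * t / a) ^ (-lam) *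
        (1 - lam * (c₁ * t / a) /
          ((Real.exp 1 + c₁ * t / a) * Real.log (Real.exp 1 + c₁ * t / a)))
        - C * ((n : ℝ) - 1)) / t) t := by
  have hL : 0 < Real.log (Real.exp 1 + c₁ * t / a) := one_pos.trans (one_lt_log_exp_one_add hu)
  have hE : 0 < Real.exp 1 + c₁ * t / a := by positivity
  have hlin : HasDerivAt (fun s : ℝ => c₁ * s / a) (c₁ * t / a / t) t := by
    refine (((hasDerivAt_id t).const_mul c₁).div_const a).congr_deriv ?_
    rw [mul_one, div_right_comm, mul_div_cancel_right₀ _ ht.ne']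
  have hpow := ((hlin.const_add (Real.exp 1)).log hE.ne').rpow_const (p := -lam) (Or.inl hL.ne')
  have h := (((hlin.mul hpow).sub_const (Real.log (Real.log (1 + a) + 𝒞 a))).sub
    ((Real.hasDerivAt_log ht.ne').const_mul (C * ((n : ℝ) - 1)))).sub_const (2 * Real.log a)
  refine h.congr_deriv ?_
  rw [Real.rpow_sub_one hL.ne']
  generalize Real.log (Real.exp 1 + c₁ * t / a) ^ (-lam) = P
  generalize Real.log (Real.exp 1 + c₁ * t / a) = L at *
  generalize c₁ * t / a = u at *
  field_simp
  ring

theorem le_mul_log_rpow_neg_mul {lam K u : ℝ} (hu : 0 < u)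
    (h1 : 2 * lam ≤ Real.log (Real.exp 1 + u))
    (h2 : 2 * K * Real.log (Real.exp 1 + u) ^ lam ≤ u) :
    K ≤ u * Real.log (Real.exp 1 + u) ^ (-lam) *
      (1 - lam * u / ((Real.exp 1 + u) * Real.log (Real.exp 1 + u))) := by
  have hL : 0 < Real.log (Real.exp 1 + u) := one_pos.trans (one_lt_log_exp_one_add hu)
  have he : 0 < Real.exp 1 := Real.exp_pos 1
  have hfactor : 1 / 2 ≤ 1 - lam * u / ((Real.exp 1 + u) * Real.log (Real.exp 1 + u)) := by
    have : lam * u / ((Real.exp 1 + u) * Real.log (Real.exp 1 + u)) ≤ 1 / 2 := by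
      rw [div_le_iff₀ (by positivity)]
      nlinarith [mul_le_mul_of_nonneg_left h1 hu.le, mul_pos he hL]
    linarith
  have hbound : 2 * K ≤ u * Real.log (Real.exp 1 + u) ^ (-lam) := by
    rw [Real.rpow_neg hL.le, ← div_eq_mul_inv, le_div_iff₀ (by positivity)]
    exact h2
  have hP : 0 ≤ u * Real.log (Real.exp 1 + u) ^ (-lam) := by positivity
  linarith [mul_le_mul_of_nonneg_left hfactor hP]

/-- For all sufficiently large `a`, the derivative of `f_a` is nonnegative
for `t ≥ a (log a)^(1+ε̃)`; in particular `f_a` is nondecreasing on that ray. -/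
theorem fA_deriv_nonneg (lam c₁ C ε' : ℝ) (n : ℕ)
    (hlam : 1 < lam) (hc₁ : 0 < c₁) (hC : 0 < C) (hn : 2 ≤ n) (hε' : 0 < ε')
    (𝒞 : ℝ → ℝ) (h𝒞nonneg : ∀ x, 0 ≤ x → 0 ≤ 𝒞 x)
    (h𝒞bdd : ∃ M : ℝ, ∀ x, 0 ≤ x → 𝒞 x ≤ M) :
    ∃ a₀ : ℝ, Real.exp 1 < a₀ ∧ ∀ a, a₀ ≤ a →
      (∀ t, a * Real.log a ^ (1 + ε') ≤ t → 0 ≤ deriv (fA c₁ C lam n 𝒞 a) t) ∧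
      MonotoneOn (fA c₁ C lam n 𝒞 a) (Set.Ici (a * Real.log a ^ (1 + ε'))) := by
  have hK : 0 < C * ((n : ℝ) - 1) := by
    have : (2 : ℝ) ≤ n := by exact_mod_cast hn
    exact mul_pos hC (by linarith)
  obtain ⟨U, hU⟩ := Filter.eventually_atTop.1 (eventually_log_exp_one_add_bounds lam _ hK)
  have htend : Filter.Tendsto (fun a : ℝ => c₁ * Real.log a ^ (1 + ε')) Filter.atTop
      Filter.atTop :=
    ((tendsto_rpow_atTop (by linarith : 0 < 1 + ε')).comp
      Real.tendsto_log_atTop).const_mul_atTop hc₁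
  obtain ⟨A, hA⟩ := Filter.eventually_atTop.1 (htend.eventually_ge_atTop U)
  refine ⟨max A (Real.exp 1 + 1), lt_max_of_lt_right (by linarith), fun a ha => ?_⟩
  have ha0 : 0 < a := by linarith [le_of_max_le_right ha, Real.exp_pos 1]
  have hlarge : ∀ t, a * Real.log a ^ (1 + ε') ≤ t → U ≤ c₁ * t / a := fun t ht => by
    refine (hA a (le_of_max_le_left ha)).trans ?_
    rw [le_div_iff₀ ha0]
    linarith [mul_le_mul_of_nonneg_left ht hc₁.le]
  have hpos : ∀ t, a * Real.log a ^ (1 + ε') ≤ t → 0 < t := fun t ht => by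
    have h := (hU _ (hlarge t ht)).1
    rw [div_pos_iff_of_pos_right ha0] at h
    exact (mul_pos_iff_of_pos_left hc₁).1 h
  have hderiv := fun t (ht : a * Real.log a ^ (1 + ε') ≤ t) =>
    hasDerivAt_fA c₁ C lam n 𝒞 (hpos t ht) (hU _ (hlarge t ht)).1
  have hnonneg : ∀ t, a * Real.log a ^ (1 + ε') ≤ t → 0 ≤ deriv (fA c₁ C lam n 𝒞 a) t := by
    intro t ht
    obtain ⟨hu, h1, h2⟩ := hU _ (hlarge t ht)
    rw [(hderiv t ht).deriv]
    exact div_nonneg (sub_nonneg.2 (le_mul_log_rpow_neg_mul hu h1 h2))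
      (hpos t ht).le
  refine ⟨hnonneg, monotoneOn_of_deriv_nonneg (convex_Ici _)
    (fun t ht => (hderiv t ht).continuousAt.continuousWithinAt) (fun t ht => ?_)
    (fun t ht => hnonneg t (interior_subset ht))⟩
  exact (hderiv t (interior_subset ht)).differentiableAt.differentiableWithinAt
end
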